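/- arXiv:2509.07781 — 3 statements merged into one kernel-verified Lean document; each statement's English description precedes it below -/
import Mathlib

section
/- For all messages m m' : M, if D m ∩ D m' is nonempty then L m ∈ P m' or L m' ∈ P m: if two multicast messages share a destination group, then the least common ancestor of one of them lies on the ordering path (subtree) of the other. (The paper's lemma that lca(m) ∈ subtree(m') or lca(m') ∈ subtree(m) for messages with a common destination.) -/
/-- The ancestor relation: `a` is an ancestor of `b` iff some iterate of the
parent function maps `b` to `a`. -/
def anc {G : Type*} (p : G → G) (a b : G) : Prop := ∃ k : ℕ, p^[k] b = a

/-- The ordering path of a message `m`: the groups lying on a downward path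
from the least common ancestor `L m` to some destination of `m`. -/
def orderPath {G M : Type*} (p : G → G) (D : M → Set G) (L : M → G) (m : M) : Set G :=
  {g : G | anc p (L m) g ∧ ∃ x ∈ D m, anc p g x}

/-- Two ancestors of the same element are comparable. -/
theorem anc_total_of_common_descendant {G : Type*} {p : G → G} {a b x : G}
    (ha : anc p a x) (hb : anc p b x) : anc p a b ∨ anc p b a := by
  obtain ⟨i, rfl⟩ := ha
  obtain ⟨j, rfl⟩ := hb
  rcases le_total i j with hij | hji
  · exact Or.inr ⟨j - i, by rw [← Function.iterate_add_apply, Nat.sub_add_cancel hij]⟩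
  · exact Or.inl ⟨i - j, by rw [← Function.iterate_add_apply, Nat.sub_add_cancel hji]⟩

/-- If two multicast messages share a destination group, then the least common
ancestor of one of them lies on the ordering path of the other. -/
theorem lca_mem_path_of_common_dst {G M : Type*} (p : G → G)
    (D : M → Set G) (L : M → G)
    (hL : ∀ m : M, ∀ g ∈ D m, anc p (L m) g)
    (m m' : M) (h : (D m ∩ D m').Nonempty) :
    L m ∈ orderPath p D L m' ∨ L m' ∈ orderPath p D L m := by
  obtain ⟨x, hx, hx'⟩ := h
  exact (anc_total_of_common_descendant (hL m x hx) (hL m' x hx')).symm.imp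
    (fun hanc => ⟨hanc, x, hx', hL m x hx⟩) (fun hanc => ⟨hanc, x, hx, hL m' x hx'⟩)
end

section
/- For all messages m m' : M, if P m ∩ P m' is nonempty then it has a greatest element under the ancestor relation: there exists ℓ ∈ P m ∩ P m' such that anc ℓ g for every g ∈ P m ∩ P m'; moreover ℓ can be chosen to be L m or L m' (whichever of the two least common ancestors is deeper in the tree). -/
theorem anc_refl {G : Type*} (p : G → G) (a : G) : anc p a a := ⟨0, rfl⟩

theorem anc_trans {G : Type*} {p : G → G} {a b c : G} (hab : anc p a b) (hbc : anc p b c) :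
    anc p a c := by
  obtain ⟨k, rfl⟩ := hab
  obtain ⟨n, rfl⟩ := hbc
  exact ⟨k + n, Function.iterate_add_apply p k n c⟩

/-- Two ancestors of the same element are comparable. -/
theorem anc_total_of_anc {G : Type*} {p : G → G} {a b c : G} (ha : anc p a c) (hb : anc p b c) :
    anc p a b ∨ anc p b a := by
  obtain ⟨k, rfl⟩ := ha
  obtain ⟨n, rfl⟩ := hb
  rcases le_total n k with h | h
  · exact Or.inl ⟨k - n, by rw [← Function.iterate_add_apply, Nat.sub_add_cancel h]⟩
  · exact Or.inr ⟨n - k, by rw [← Function.iterate_add_apply, Nat.sub_add_cancel h]⟩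

/-- If the ordering paths of two messages intersect, the intersection has a
greatest element under the ancestor relation, and this element can be chosen
to be one of the two least common ancestors. -/
theorem path_inter_has_greatest {G M : Type*} (p : G → G)
    (D : M → Set G) (L : M → G)
    (hL : ∀ m : M, ∀ g ∈ D m, anc p (L m) g)
    (m m' : M) (h : (orderPath p D L m ∩ orderPath p D L m').Nonempty) :
    ∃ ℓ : G, (ℓ = L m ∨ ℓ = L m') ∧ ℓ ∈ orderPath p D L m ∩ orderPath p D L m' ∧
      ∀ g ∈ orderPath p D L m ∩ orderPath p D L m', anc p ℓ g := by
  obtain ⟨g, ⟨hg, x, hx, hgx⟩, hg', x', hx', hgx'⟩ := h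
  rcases anc_total_of_anc hg hg' with hle | hle
  · exact ⟨L m', Or.inr rfl, ⟨⟨hle, x, hx, anc_trans hg' hgx⟩,
      anc_refl p _, x', hx', hL m' x' hx'⟩, fun _ hy => hy.2.1⟩
  · exact ⟨L m, Or.inl rfl, ⟨⟨anc_refl p _, x, hx, hL m x hx⟩,
      hle, x', hx', anc_trans hg hgx'⟩, fun _ hy => hy.1.1⟩
end

section
/- For all messages m m' : M and all groups g h : G with g ∈ P m ∩ P m', h ∈ P m ∩ P m', and anc g h, one has: ord g m m' holds iff ord h m m' holds. (The paper's lemma that if an ancestor group and a descendant group both order two messages, they order them identically: order established at a group is preserved down the tree path.) -/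
theorem mem_orderPath_of_anc_of_anc {G M : Type*} {p : G → G} {D : M → Set G} {L : M → G}
    {m : M} {a b c : G} (ha : a ∈ orderPath p D L m) (hc : c ∈ orderPath p D L m)
    (hab : anc p a b) (hbc : anc p b c) : b ∈ orderPath p D L m := by
  obtain ⟨x, hx, hcx⟩ := hc.2
  exact ⟨anc_trans ha.1 hab, x, hx, anc_trans hbc hcx⟩

/-- If an ancestor group and a descendant group both order two messages, they
order them identically: order established at a group is preserved down the
tree path. -/
theorem ord_eq_of_anc {G M : Type*} (p : G → G)
    (D : M → Set G) (L : M → G)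
    (hL : ∀ m : M, ∀ g ∈ D m, anc p (L m) g)
    (ord : G → M → M → Prop)
    (hirr : ∀ g : G, ∀ m : M, ¬ ord g m m)
    (htrans : ∀ g : G, ∀ m₁ m₂ m₃ : M, ord g m₁ m₂ → ord g m₂ m₃ → ord g m₁ m₃)
    (hloc : ∀ g h : G, p h = g → ∀ m m' : M,
      g ∈ orderPath p D L m ∩ orderPath p D L m' →
      h ∈ orderPath p D L m ∩ orderPath p D L m' →
      (ord g m m' ↔ ord h m m'))
    (m m' : M) (g h : G)
    (hg : g ∈ orderPath p D L m ∩ orderPath p D L m')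
    (hh : h ∈ orderPath p D L m ∩ orderPath p D L m')
    (hanc : anc p g h) :
    (ord g m m' ↔ ord h m m') := by
  obtain ⟨k, hk⟩ := hanc
  induction k generalizing h with
  | zero => rw [← hk, Function.iterate_zero_apply]
  | succ k ih =>
    rw [Function.iterate_succ_apply] at hk
    have hgp : anc p g (p h) := ⟨k, hk⟩
    have hph : anc p (p h) h := ⟨1, rfl⟩
    have hp : p h ∈ orderPath p D L m ∩ orderPath p D L m' :=
      ⟨mem_orderPath_of_anc_of_anc hg.1 hh.1 hgp hph,
        mem_orderPath_of_anc_of_anc hg.2 hh.2 hgp hph⟩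
    exact (ih (p h) hp hk).trans (hloc (p h) h rfl m m' hp hh)
end
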